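/- Let L be a ℂ[∂]-module such that (L, ∘_λ) is a commutative associative conformal algebra and (L, [·_λ·]) is a Lie conformal algebra. Then (L, ∘_λ, [·_λ·]) is simultaneously a Poisson conformal algebra and a transposed Poisson conformal algebra if and only if a∘_λ[b_μ c] = 0, [b_{μ−λ} a]∘_μ c = 0, and [(a∘_λ b)_{λ+μ} c] = 0 for all a, b, c ∈ L (as identities of polynomials in λ, μ). -/

import Mathlib

/-!
We model a `ℂ[∂]`-module as a complex vector space `L` together with an
endomorphism `D` (the action of `∂`).  A `λ`-product (or `λ`-bracket) is a
`ℂ`-bilinear map `L → L → L[λ]`, where the polynomial `x ∘_λ y = Σₙ λⁿ • cₙ`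
is encoded by its finitely supported family of coefficients `ℕ →₀ L`.
Substitution of the variable `λ` by a complex scalar, or by an operator such
as `-∂-λ`, is given by `ev`; since `ℂ` is infinite, an identity of
polynomials in (several) variables `λ, μ, γ` with coefficients in a complex
vector space holds formally if and only if it holds for all complex values
of the variables, which is how all identities are stated below.
-/

namespace ConfFormal

variable {L : Type*} [AddCommGroup L] [Module ℂ L]

/-- Evaluation of a polynomial `p = Σₙ λⁿ • pₙ` with coefficients in `L`
(encoded as the family of its coefficients) at an endomorphism `T` of `L`
(for instance at a scalar `λ`, or at an operator such as `-∂-λ`). -/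
noncomputable def ev (T : Module.End ℂ L) (p : ℕ →₀ L) : L :=
  p.sum fun n x => (T ^ n) x

/-- `app m T x y` is `x ∘_T y` : the `λ`-product `x ∘_λ y` recorded by the
`ℂ`-bilinear coefficient map `m`, with the variable `λ` substituted by the
endomorphism `T`. -/
noncomputable def app (m : L →ₗ[ℂ] L →ₗ[ℂ] (ℕ →₀ L)) (T : Module.End ℂ L) (x y : L) : L :=
  ev T (m x y)

/-- The scalar `c` viewed as an endomorphism of `L`. -/
noncomputable def sc (c : ℂ) : Module.End ℂ L := c • (1 : Module.End ℂ L)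

/-- `(L, D, m)` is a conformal algebra: conformal sesquilinearity holds. -/
structure IsConfAlg (D : Module.End ℂ L) (m : L →ₗ[ℂ] L →ₗ[ℂ] (ℕ →₀ L)) : Prop where
  sesq_left : ∀ (x y : L) (l : ℂ), app m (sc l) (D x) y = -l • app m (sc l) x y
  sesq_right : ∀ (x y : L) (l : ℂ),
    app m (sc l) x (D y) = D (app m (sc l) x y) + l • app m (sc l) x y

/-- `(L, D, m)` is a commutative associative conformal algebra. -/
structure IsCommAssocConfAlg (D : Module.End ℂ L) (m : L →ₗ[ℂ] L →ₗ[ℂ] (ℕ →₀ L))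
    extends IsConfAlg D m : Prop where
  assoc : ∀ (x y z : L) (l u : ℂ),
    app m (sc l) x (app m (sc u) y z) = app m (sc (l + u)) (app m (sc l) x y) z
  comm : ∀ (x y : L) (l : ℂ), app m (sc l) x y = app m (-(D + sc l)) y x

/-- `(L, D, br)` is a Lie conformal algebra. -/
structure IsLieConfAlg (D : Module.End ℂ L) (br : L →ₗ[ℂ] L →ₗ[ℂ] (ℕ →₀ L)) : Prop where
  sesq_left : ∀ (x y : L) (l : ℂ), app br (sc l) (D x) y = -l • app br (sc l) x y
  skew : ∀ (x y : L) (l : ℂ), app br (sc l) x y = -app br (-(sc l + D)) y x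
  jacobi : ∀ (x y z : L) (l u : ℂ),
    app br (sc l) x (app br (sc u) y z) =
      app br (sc (l + u)) (app br (sc l) x y) z + app br (sc u) y (app br (sc l) x z)

/-- `(L, D, m, br)` is a transposed Poisson conformal algebra. -/
structure IsTPCA (D : Module.End ℂ L) (m br : L →ₗ[ℂ] L →ₗ[ℂ] (ℕ →₀ L)) : Prop where
  commAssoc : IsCommAssocConfAlg D m
  lie : IsLieConfAlg D br
  tLeibniz : ∀ (x y z : L) (l u : ℂ),
    (2 : ℂ) • app m (sc l) x (app br (sc u) y z) =
      app br (sc (l + u)) (app m (sc l) x y) z + app br (sc u) y (app m (sc l) x z)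


/-- `(L, D, m, br)` is a Poisson conformal algebra. -/
structure IsPCA (D : Module.End ℂ L) (m br : L →ₗ[ℂ] L →ₗ[ℂ] (ℕ →₀ L)) : Prop where
  commAssoc : IsCommAssocConfAlg D m
  lie : IsLieConfAlg D br
  leibniz : ∀ (x y z : L) (l u : ℂ),
    app br (sc l) x (app m (sc u) y z) =
      app m (sc (l + u)) (app br (sc l) x y) z + app m (sc u) y (app br (sc l) x z)

section Substitution

/-- `ev T` as a linear map in the polynomial. -/
noncomputable def evLin (T : Module.End ℂ L) : (ℕ →₀ L) →ₗ[ℂ] L :=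
  Finsupp.lsum ℂ fun n => T ^ n

/-- `app m T` as a bilinear map. -/
noncomputable def appLin (m : L →ₗ[ℂ] L →ₗ[ℂ] (ℕ →₀ L)) (T : Module.End ℂ L) :
    L →ₗ[ℂ] L →ₗ[ℂ] L :=
  m.compr₂ (evLin T)

theorem appLin_apply (m : L →ₗ[ℂ] L →ₗ[ℂ] (ℕ →₀ L)) (T : Module.End ℂ L) (x y : L) :
    appLin m T x y = app m T x y := rfl

theorem app_neg_left (m : L →ₗ[ℂ] L →ₗ[ℂ] (ℕ →₀ L)) (T : Module.End ℂ L) (x y : L) :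
    app m T (-x) y = -app m T x y := by
  simp [← appLin_apply]

theorem app_neg_right (m : L →ₗ[ℂ] L →ₗ[ℂ] (ℕ →₀ L)) (T : Module.End ℂ L) (x y : L) :
    app m T x (-y) = -app m T x y := by
  simp [← appLin_apply]

theorem sc_apply (c : ℂ) (x : L) : sc c x = c • x := rfl

theorem sc_pow_apply (c : ℂ) (n : ℕ) (x : L) : (sc c ^ n) x = c ^ n • x := by
  simp [sc, smul_pow]

/-- A linear map intertwining `S` and `S'` carries evaluation at `S` to evaluation at `S'`. -/
theorem map_ev {S S' : Module.End ℂ L} (g : L →ₗ[ℂ] L) (h : ∀ x, g (S x) = S' (g x))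
    (p : ℕ →₀ L) : g (ev S p) = p.sum fun n x => (S' ^ n) (g x) := by
  have hpow : ∀ n x, g ((S ^ n) x) = (S' ^ n) (g x) := by
    intro n
    induction n with
    | zero => simp
    | succ n ih => intro x; rw [pow_succ, pow_succ, Module.End.mul_apply, ih, h,
        Module.End.mul_apply]
  simp [ev, Finsupp.sum, map_sum, hpow]

/-- A polynomial with coefficients in `L` vanishing at every scalar is zero. -/
theorem eq_zero_of_ev_sc_eq_zero {p : ℕ →₀ L} (h : ∀ c : ℂ, ev (sc c) p = 0) : p = 0 := by
  ext n
  rw [Finsupp.zero_apply, ← Module.forall_dual_apply_eq_zero_iff ℂ]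
  intro φ
  have hq : p.sum (fun k x => Polynomial.monomial k (φ x)) = 0 := by
    refine Polynomial.funext fun c => ?_
    have := congrArg φ (h c)
    simp only [ev, Finsupp.sum, sc_pow_apply, map_sum, map_smul, smul_eq_mul, map_zero] at this
    simp only [Finsupp.sum, Polynomial.eval_finsetSum, Polynomial.eval_monomial,
      Polynomial.eval_zero]
    simpa only [mul_comm] using this
  have hn := congrArg (Polynomial.coeff · n) hq
  simp only [Finsupp.sum, Polynomial.finsetSum_coeff, Polynomial.coeff_monomial,
    Polynomial.coeff_zero, Finset.sum_ite_eq'] at hn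
  by_cases hmem : n ∈ p.support
  · simpa [hmem] using hn
  · simp [Finsupp.notMem_support_iff.mp hmem]

/-- The functions `End L → L` given by evaluating a polynomial with coefficients in `L`. -/
noncomputable def polyFun (L : Type*) [AddCommGroup L] [Module ℂ L] :
    Submodule ℂ (Module.End ℂ L → L) :=
  LinearMap.range (LinearMap.pi evLin)

theorem ev_mem_polyFun (p : ℕ →₀ L) : (fun T => ev T p) ∈ polyFun L :=
  ⟨p, rfl⟩

theorem const_mem_polyFun (x : L) : (fun _ => x) ∈ polyFun L := by
  convert ev_mem_polyFun (Finsupp.single 0 x) using 2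
  simp [ev]

theorem apply_mem_polyFun {f : Module.End ℂ L → L} (hf : f ∈ polyFun L) :
    (fun T => T (f T)) ∈ polyFun L := by
  obtain ⟨p, rfl⟩ := hf
  refine ⟨p.mapDomain (· + 1), funext fun T => ?_⟩
  change ev T (p.mapDomain (· + 1)) = T (ev T p)
  rw [ev, Finsupp.sum_mapDomain_index (by simp) (by simp)]
  simp [ev, Finsupp.sum, pow_succ', map_sum]

theorem sc_add_apply_mem_polyFun {f : Module.End ℂ L → L} (hf : f ∈ polyFun L) (c : ℂ) :
    (fun T => (sc c + T) (f T)) ∈ polyFun L :=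
  (polyFun L).add_mem ((polyFun L).smul_mem c hf) (apply_mem_polyFun hf)

theorem sc_add_pow_mem_polyFun {f : Module.End ℂ L → L} (hf : f ∈ polyFun L) (c : ℂ) (n : ℕ) :
    (fun T => ((sc c + T) ^ n) (f T)) ∈ polyFun L := by
  induction n with
  | zero => simpa using hf
  | succ n ih => simpa [pow_succ'] using sc_add_apply_mem_polyFun ih c

theorem pow_mem_polyFun {f : Module.End ℂ L → L} (hf : f ∈ polyFun L) (n : ℕ) :
    (fun T => (T ^ n) (f T)) ∈ polyFun L := by
  simpa [sc] using sc_add_pow_mem_polyFun hf 0 n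

theorem sum_mem_polyFun (p : ℕ →₀ L) {f : ℕ → L → Module.End ℂ L → L}
    (hf : ∀ n x, f n x ∈ polyFun L) : (fun T => p.sum fun n x => f n x T) ∈ polyFun L := by
  have h : (fun T => p.sum fun n x => f n x T) = ∑ n ∈ p.support, f n (p n) := by
    ext T
    simp [Finsupp.sum]
  rw [h]
  exact (polyFun L).sum_mem fun n _ => hf n (p n)

theorem ev_sc_add_mem_polyFun (c : ℂ) (p : ℕ →₀ L) :
    (fun T => ev (sc c + T) p) ∈ polyFun L :=
  sum_mem_polyFun p fun n x => sc_add_pow_mem_polyFun (const_mem_polyFun x) c n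

/-- A polynomial function vanishing at all scalars vanishes at all endomorphisms. -/
theorem eq_zero_of_mem_polyFun {f : Module.End ℂ L → L} (hf : f ∈ polyFun L)
    (h : ∀ c : ℂ, f (sc c) = 0) (T : Module.End ℂ L) : f T = 0 := by
  obtain ⟨p, rfl⟩ := hf
  have hp : p = 0 := eq_zero_of_ev_sc_eq_zero h
  simp [hp]

end Substitution

section Identities

variable {D : Module.End ℂ L}
  {m br : L →ₗ[ℂ] L →ₗ[ℂ] (ℕ →₀ L)}

/-- Under left sesquilinearity, `∂` acts as `-(λ+μ)` on the left argument of a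
`(λ+μ)`-product, so `-∂-λ` may be replaced there by `μ`. -/
theorem app_ev_left (h : ∀ (x y : L) (l : ℂ), app m (sc l) (D x) y = -l • app m (sc l) x y)
    (p : ℕ →₀ L) (c : L) (l u : ℂ) :
    app m (sc (l + u)) (ev (-(D + sc l)) p) c = app m (sc (l + u)) (ev (sc u) p) c := by
  have key := fun S hS => map_ev (S := S) (S' := sc u) ((appLin m (sc (l + u))).flip c) hS p
  simp only [LinearMap.flip_apply, appLin_apply] at key
  rw [key _ fun x => ?_, key _ fun x => ?_]
  · simp [sc_apply, ← appLin_apply]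
  · rw [← sub_eq_zero]
    simp only [LinearMap.neg_apply, LinearMap.add_apply, app_neg_left, sc_apply]
    have := h x c (l + u)
    simp only [← appLin_apply, map_add, LinearMap.add_apply, map_smul,
      LinearMap.smul_apply] at this ⊢
    rw [this]
    module

/-- Under right sesquilinearity, `-∂-μ` on the right argument of a `λ`-product becomes
`-∂-λ-μ` on the product. -/
theorem IsConfAlg.app_ev_right (h : IsConfAlg D m) (p : ℕ →₀ L) (a : L) (l u : ℂ) :
    app m (sc l) a (ev (-(D + sc u)) p) =
      p.sum fun n x => ((-(D + sc l + sc u) : Module.End ℂ L) ^ n) (app m (sc l) a x) := by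
  refine map_ev (appLin m (sc l) a) (fun x => ?_) p
  have := h.sesq_right a x l
  simp only [← appLin_apply] at this
  simp only [LinearMap.neg_apply, LinearMap.add_apply, sc_apply, map_neg, map_add, map_smul, this]

theorem IsCommAssocConfAlg.app_app_swap (hm : IsCommAssocConfAlg D m)
    (hbr : IsLieConfAlg D br) (a b c : L) (l u : ℂ) :
    app br (sc (l + u)) (app m (sc l) a b) c = app br (sc (l + u)) (app m (sc u) b a) c := by
  rw [hm.comm a b l]
  exact app_ev_left hbr.sesq_left _ c l u

theorem IsLieConfAlg.app_app_swap (hbr : IsLieConfAlg D br) (hm : IsConfAlg D m)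
    (a b c : L) (l u : ℂ) :
    app m (sc (l + u)) (app br (sc l) a b) c = -app m (sc (l + u)) (app br (sc u) b a) c := by
  rw [hbr.skew a b l, app_neg_left, add_comm (sc l) D]
  exact congrArg _ (app_ev_left hm.sesq_left _ c l u)

theorem app_sub_app_eq_two_smul (hP : IsPCA D m br) (hT : IsTPCA D m br) (a b c : L) (l u : ℂ) :
    app m (sc l) a (app br (sc u) b c) - app m (sc u) b (app br (sc l) a c) =
      (2 : ℂ) • app m (sc (l + u)) (app br (sc u) b a) c := by
  have h₁ := hT.tLeibniz a b c l u
  have h₂ := hT.tLeibniz b a c u l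
  rw [hP.leibniz b a c u l] at h₁
  rw [hP.leibniz a b c l u] at h₂
  rw [add_comm u l] at h₁ h₂
  have h₃ := hP.commAssoc.app_app_swap hP.lie a b c l u
  have h₄ := hP.lie.app_app_swap hP.commAssoc.toIsConfAlg a b c l u
  rw [h₃] at h₁
  rw [h₄] at h₂
  linear_combination (norm := module) h₁ - h₂

/-- Exchanging `b` and `c` in `app_sub_app_eq_two_smul` and substituting `-∂-λ-μ` for `μ`. -/
theorem app_sub_app_eq_two_smul' (hP : IsPCA D m br) (hT : IsTPCA D m br)
    (a b c : L) (l u : ℂ) :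
    app m (sc l) a (app br (sc u) b c) - app m (sc (l + u)) (app br (sc u) b a) c =
      (2 : ℂ) • app m (sc u) b (app br (sc l) a c) := by
  have hm := hP.commAssoc
  have hbr := hP.lie
  let f₁ : Module.End ℂ L → L := fun T =>
    (br c b).sum fun n x => (T ^ n) (app m (sc l) a x)
  let f₂ : Module.End ℂ L → L := fun T => app m T c (app br (sc l) a b)
  let f₃ : Module.End ℂ L → L := fun T =>
    (br c a).sum fun n x => (T ^ n) (app m (sc l + T) x b)
  have hf : f₁ - f₂ - (2 : ℂ) • f₃ ∈ polyFun L := by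
    refine sub_mem (sub_mem ?_ (ev_mem_polyFun _)) (Submodule.smul_mem _ _ ?_)
    · exact sum_mem_polyFun _ fun n x => pow_mem_polyFun (const_mem_polyFun _) n
    · exact sum_mem_polyFun _ fun n x => pow_mem_polyFun (ev_sc_add_mem_polyFun l _) n
  have hzero : ∀ v : ℂ, (f₁ - f₂ - (2 : ℂ) • f₃) (sc v) = 0 := by
    intro v
    have e₁ : f₁ (sc v) = app m (sc l) a (app br (sc v) c b) :=
      (map_ev (appLin m (sc l) a) (fun x => by simp [sc_apply]) _).symm
    have e₃ : f₃ (sc v) = app m (sc (l + v)) (app br (sc v) c a) b := by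
      have hadd : sc l + sc v = (sc (l + v) : Module.End ℂ L) := (add_smul l v _).symm
      simp only [f₃, hadd]
      exact (map_ev ((appLin m (sc (l + v))).flip b) (fun x => by simp [sc_apply]) _).symm
    simp only [Pi.sub_apply, Pi.smul_apply, e₁, e₃, f₂]
    rw [sub_eq_zero]
    exact app_sub_app_eq_two_smul hP hT a c b l v
  have key := eq_zero_of_mem_polyFun hf hzero (-(D + sc l + sc u))
  have e₁ : f₁ (-(D + sc l + sc u)) = -app m (sc l) a (app br (sc u) b c) := by
    rw [hbr.skew b c u, app_neg_right, neg_neg, add_comm (sc u) D]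
    exact (hm.toIsConfAlg.app_ev_right (br c b) a l u).symm
  have e₂ : f₂ (-(D + sc l + sc u)) = -app m (sc (l + u)) (app br (sc u) b a) c := by
    rw [← hbr.app_app_swap hm.toIsConfAlg, hm.comm _ c]
    simp only [f₂, sc, add_smul, add_assoc]
  have e₃ : f₃ (-(D + sc l + sc u)) = -app m (sc u) b (app br (sc l) a c) := by
    rw [hbr.skew a c l, app_neg_right, neg_neg, add_comm (sc l) D]
    have hop : sc l + -(D + sc l + sc u) = -(D + sc u) := by abel
    simp only [f₃, hop, ← hm.comm]
    rw [add_right_comm]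
    exact (hm.toIsConfAlg.app_ev_right (br c a) b u l).symm
  simp only [Pi.sub_apply, Pi.smul_apply, e₁, e₂, e₃] at key
  linear_combination (norm := module) -key

theorem app_app_br_eq_zero (hP : IsPCA D m br) (hT : IsTPCA D m br) (a b c : L) (l u : ℂ) :
    app m (sc l) a (app br (sc u) b c) = 0 ∧
      app m (sc (l + u)) (app br (sc u) b a) c = 0 := by
  have h₁ := app_sub_app_eq_two_smul hP hT a b c l u
  have h₂ := app_sub_app_eq_two_smul' hP hT a b c l u
  have h₃ := app_sub_app_eq_two_smul' hP hT b a c u l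
  rw [add_comm u l, hP.lie.app_app_swap hP.commAssoc.toIsConfAlg a b c l u] at h₃
  have hG : app m (sc (l + u)) (app br (sc u) b a) c = 0 := by
    linear_combination (norm := module) (-3 / 4 : ℂ) • h₁ + (1 / 4 : ℂ) • h₂ - (1 / 4 : ℂ) • h₃
  rw [hG] at h₁ h₂
  refine ⟨?_, hG⟩
  linear_combination (norm := module) (2 : ℂ) • h₁ - h₂

/-- If every bracket `[x_λ y]` vanishes, so does every bracket `[y_λ x]`. -/
theorem IsLieConfAlg.app_eq_zero_of_swap (hbr : IsLieConfAlg D br) {x y : L}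
    (h : ∀ v : ℂ, app br (sc v) x y = 0) (l : ℂ) : app br (sc l) y x = 0 := by
  have h0 : br x y = 0 := eq_zero_of_ev_sc_eq_zero h
  rw [hbr.skew y x l, app, h0]
  simp [ev]

end Identities

/-- Given a commutative associative conformal algebra and a
Lie conformal algebra structure on `L`, the pair is simultaneously a Poisson
conformal algebra and a transposed Poisson conformal algebra if and only if
`a∘_λ[b_μ c] = [b_{μ−λ} a]∘_μ c = [(a∘_λ b)_{λ+μ} c] = 0` for all `a, b, c`. -/
theorem pca_and_tpca_iff {L : Type*} [AddCommGroup L] [Module ℂ L]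
    (D : Module.End ℂ L) (m br : L →ₗ[ℂ] L →ₗ[ℂ] (ℕ →₀ L))
    (hm : IsCommAssocConfAlg D m) (hbr : IsLieConfAlg D br) :
    (IsPCA D m br ∧ IsTPCA D m br) ↔
      ∀ (a b c : L) (l u : ℂ),
        app m (sc l) a (app br (sc u) b c) = 0 ∧
        app m (sc u) (app br (sc (u - l)) b a) c = 0 ∧
        app br (sc (l + u)) (app m (sc l) a b) c = 0 := by
  constructor
  · rintro ⟨hP, hT⟩ a b c l u
    have h₁ := fun b c u => (app_app_br_eq_zero hP hT a b c l u).1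
    have h₂ := fun c l u => (app_app_br_eq_zero hP hT a b c l u).2
    refine ⟨h₁ b c u, ?_, ?_⟩
    · simpa using h₂ c l (u - l)
    · have h := hT.tLeibniz a b c l u
      rw [hP.leibniz b a c u l, add_comm u l, h₁ b c u, h₂ c l u] at h
      simpa using h.symm
  · intro h
    have hbm : ∀ (a b c : L) (l u : ℂ), app br (sc l) a (app m (sc u) b c) = 0 := by
      intro a b c l u
      refine hbr.app_eq_zero_of_swap (fun v => ?_) l
      simpa using (h b c a u (v - u)).2.2
    refine ⟨⟨hm, hbr, fun x y z l u => ?_⟩, ⟨hm, hbr, fun x y z l u => ?_⟩⟩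
    · have h₂ := (h y x z u (l + u)).2.1
      rw [add_sub_cancel_right] at h₂
      rw [hbm, h₂, (h y x z u l).1, add_zero]
    · rw [hbm, (h x y z l u).1, (h x y z l u).2.2, smul_zero, add_zero]

end ConfFormal
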